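/- arXiv:1102.1138 — 2 statements merged into one kernel-verified Lean document; each statement's English description precedes it below -/
import Mathlib

section
/- In a finite bipartite graph G=(A,B,E), if X⊆A is an A-critical set and Y⊆B is a B-critical set, then X∪Y is a d-critical set of G, i.e., d(X∪Y)=d_c(G). -/
open Finset

open scoped Classical

variable {V : Type*} [Fintype V] [DecidableEq V]

/-- The neighborhood `N(X)` of a finite set of vertices `X`. -/
noncomputable def nbr (G : SimpleGraph V) (X : Finset V) : Finset V :=
  Finset.univ.filter fun v => ∃ x ∈ X, G.Adj v x

/-- The difference `d(X) = |X| - |N(X)|` of a set of vertices. -/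
noncomputable def diffZ (G : SimpleGraph V) (X : Finset V) : ℤ :=
  (X.card : ℤ) - ((nbr G X).card : ℤ)

/-- The critical difference `d_c(G) = max {d(X) : X ⊆ V}`. -/
noncomputable def critDiff (G : SimpleGraph V) : ℤ :=
  (Finset.univ : Finset V).powerset.sup' (Finset.powerset_nonempty _) (diffZ G)

/-- A set of vertices is independent if no two of its vertices are adjacent. -/
def IsIndep (G : SimpleGraph V) (S : Finset V) : Prop :=
  ∀ u ∈ S, ∀ v ∈ S, ¬ G.Adj u v

/-- The independence number `α(G)`. -/
noncomputable def indepNum (G : SimpleGraph V) : ℕ :=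
  ((Finset.univ : Finset V).powerset.filter (IsIndep G)).sup Finset.card

/-- The critical independence difference `id_c(G) = max {d(I) : I independent}`. -/
noncomputable def idc (G : SimpleGraph V) : ℤ :=
  ((Finset.univ : Finset V).powerset.filter (IsIndep G)).sup'
    ⟨∅, by simp [IsIndep]⟩ (diffZ G)

/-- A critical independent set: an independent set `S` with `d(S) = id_c(G)`. -/
def CritIndep (G : SimpleGraph V) (S : Finset V) : Prop :=
  IsIndep G S ∧ diffZ G S = idc G

/-- A finite set of edges of `G` that are pairwise non-incident (a matching). -/
def IsMatchingSet (G : SimpleGraph V) (M : Finset (Sym2 V)) : Prop :=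
  (∀ e ∈ M, e ∈ G.edgeSet) ∧
    (M : Set (Sym2 V)).Pairwise fun e f => ∀ v : V, ¬(v ∈ e ∧ v ∈ f)

/-- The matching number `μ(G)`. -/
noncomputable def matchNum (G : SimpleGraph V) : ℕ :=
  ((Finset.univ : Finset (Sym2 V)).powerset.filter (IsMatchingSet G)).sup Finset.card

/-- A maximum independent set. -/
def IsMaxIndep (G : SimpleGraph V) (S : Finset V) : Prop :=
  IsIndep G S ∧ S.card = indepNum G

/-- `ker(G)`: the intersection of all critical independent sets. -/
noncomputable def kerSet (G : SimpleGraph V) : Finset V :=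
  Finset.univ.filter fun v => ∀ S : Finset V, CritIndep G S → v ∈ S

/-- `diadem(G)`: the union of all critical independent sets. -/
noncomputable def diademSet (G : SimpleGraph V) : Finset V :=
  Finset.univ.filter fun v => ∃ S : Finset V, CritIndep G S ∧ v ∈ S

/-- `core(G)`: the intersection of all maximum independent sets. -/
noncomputable def coreSet (G : SimpleGraph V) : Finset V :=
  Finset.univ.filter fun v => ∀ S : Finset V, IsMaxIndep G S → v ∈ S

/-- `corona(G)`: the union of all maximum independent sets. -/
noncomputable def coronaSet (G : SimpleGraph V) : Finset V :=
  Finset.univ.filter fun v => ∃ S : Finset V, IsMaxIndep G S ∧ v ∈ S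

/-- `δ₀(A) = max {δ(X) : X ⊆ A}`, the maximum deficiency over subsets of a side. -/
noncomputable def delta0 (G : SimpleGraph V) (A : Finset V) : ℤ :=
  A.powerset.sup' (Finset.powerset_nonempty _) (diffZ G)

/-- An `A`-critical set: a subset `X ⊆ A` with `δ(X) = δ₀(A)`. -/
def SideCrit (G : SimpleGraph V) (A X : Finset V) : Prop :=
  X ⊆ A ∧ diffZ G X = delta0 G A

/-- `ker_A(G)`: the intersection of all `A`-critical sets. -/
noncomputable def kerSide (G : SimpleGraph V) (A : Finset V) : Finset V :=
  Finset.univ.filter fun v => ∀ X : Finset V, SideCrit G A X → v ∈ X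

/-- `diadem_A(G)`: the union of all `A`-critical sets. -/
noncomputable def diademSide (G : SimpleGraph V) (A : Finset V) : Finset V :=
  Finset.univ.filter fun v => ∃ X : Finset V, SideCrit G A X ∧ v ∈ X

/-- `{A, B}` is a bipartition of `G`: both sides nonempty, disjoint, covering all
vertices, and every edge goes between `A` and `B`. -/
def IsBipartition (G : SimpleGraph V) (A B : Finset V) : Prop :=
  A.Nonempty ∧ B.Nonempty ∧ Disjoint A B ∧ A ∪ B = Finset.univ ∧
    ∀ u v : V, G.Adj u v → (u ∈ A ∧ v ∈ B) ∨ (u ∈ B ∧ v ∈ A)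

lemma nbr_union (G : SimpleGraph V) (X Y : Finset V) :
    nbr G (X ∪ Y) = nbr G X ∪ nbr G Y := by
  ext v
  simp only [nbr, mem_filter, mem_univ, true_and, mem_union]
  grind

lemma IsBipartition.symm {G : SimpleGraph V} {A B : Finset V} (h : IsBipartition G A B) :
    IsBipartition G B A := by
  obtain ⟨hA, hB, hd, hu, hadj⟩ := h
  exact ⟨hB, hA, hd.symm, by rw [union_comm, hu], fun u v huv => (hadj u v huv).symm⟩

lemma IsBipartition.nbr_subset {G : SimpleGraph V} {A B X : Finset V}
    (h : IsBipartition G A B) (hX : X ⊆ A) : nbr G X ⊆ B := by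
  intro v hv
  obtain ⟨-, -, hd, -, hadj⟩ := h
  simp only [nbr, mem_filter, mem_univ, true_and] at hv
  obtain ⟨x, hx, hvx⟩ := hv
  rcases hadj v x hvx with ⟨-, hxB⟩ | ⟨hvB, -⟩
  · exact absurd hxB (disjoint_left.mp hd (hX hx))
  · exact hvB

/-- In a bipartite graph the difference is additive over sets lying on opposite sides. -/
lemma IsBipartition.diffZ_union {G : SimpleGraph V} {A B X Y : Finset V}
    (h : IsBipartition G A B) (hX : X ⊆ A) (hY : Y ⊆ B) :
    diffZ G (X ∪ Y) = diffZ G X + diffZ G Y := by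
  have hd : Disjoint A B := h.2.2.1
  have hXY : Disjoint X Y := disjoint_of_subset_left hX (disjoint_of_subset_right hY hd)
  have hN : Disjoint (nbr G X) (nbr G Y) :=
    disjoint_of_subset_left (h.nbr_subset hX)
      (disjoint_of_subset_right (h.symm.nbr_subset hY) hd.symm)
  simp only [diffZ, nbr_union, card_union_of_disjoint hXY, card_union_of_disjoint hN]
  push_cast
  ring

lemma diffZ_le_delta0 (G : SimpleGraph V) {A X : Finset V} (hX : X ⊆ A) :
    diffZ G X ≤ delta0 G A :=
  le_sup' (diffZ G) (mem_powerset.mpr hX)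

/-- In a finite bipartite graph, the union of an `A`-critical set and a
`B`-critical set is a `d`-critical set. -/
theorem union_of_sideCrit_is_critical (G : SimpleGraph V) (A B : Finset V)
    (hbip : IsBipartition G A B) (X Y : Finset V)
    (hX : SideCrit G A X) (hY : SideCrit G B Y) :
    diffZ G (X ∪ Y) = critDiff G := by
  rw [critDiff]
  refine le_antisymm (le_sup' (diffZ G) (mem_powerset.mpr (subset_univ _)))
    (sup'_le _ _ fun S _ => ?_)
  have hS : S = S ∩ A ∪ S ∩ B := by
    rw [← inter_union_distrib_left, hbip.2.2.2.1, inter_univ]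
  rw [hS, hbip.diffZ_union inter_subset_right inter_subset_right,
    hbip.diffZ_union hX.1 hY.1, hX.2, hY.2]
  exact add_le_add (diffZ_le_delta0 G inter_subset_right) (diffZ_le_delta0 G inter_subset_right)
end

section
/- If G is a finite König–Egerváry graph, then |corona(G)| + |core(G)| = 2α(G). -/
open Finset

open scoped Classical

variable {V : Type*} [Fintype V] [DecidableEq V]

theorem exists_isMaxIndep (G : SimpleGraph V) : ∃ S : Finset V, IsMaxIndep G S := by
  obtain ⟨S, hS, h⟩ := Finset.exists_mem_eq_sup
    ((Finset.univ : Finset V).powerset.filter (IsIndep G)) ⟨∅, by simp [IsIndep]⟩ Finset.card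
  exact ⟨S, (Finset.mem_filter.1 hS).2, h.symm⟩

theorem exists_isMatchingSet_card_eq_matchNum (G : SimpleGraph V) :
    ∃ M : Finset (Sym2 V), IsMatchingSet G M ∧ M.card = matchNum G := by
  obtain ⟨M, hM, h⟩ := Finset.exists_mem_eq_sup
    ((Finset.univ : Finset (Sym2 V)).powerset.filter (IsMatchingSet G))
    ⟨∅, by simp [IsMatchingSet]⟩ Finset.card
  exact ⟨M, (Finset.mem_filter.1 hM).2, h.symm⟩

theorem IsMatchingSet.eq_of_mem {G : SimpleGraph V} {M : Finset (Sym2 V)}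
    (hM : IsMatchingSet G M) {e f : Sym2 V} (he : e ∈ M) (hf : f ∈ M) {v : V}
    (hve : v ∈ e) (hvf : v ∈ f) : e = f := by
  by_contra hne
  exact hM.2 he hf hne v ⟨hve, hvf⟩

theorem IsMatchingSet.eq_right {G : SimpleGraph V} {M : Finset (Sym2 V)}
    (hM : IsMatchingSet G M) {u v w : V} (hv : s(u, v) ∈ M) (hw : s(u, w) ∈ M) : v = w :=
  Sym2.congr_right.1 (hM.eq_of_mem hv hw (Sym2.mem_mk_left u v) (Sym2.mem_mk_left u w))

/-- If a matching `M` and an independent set `S` satisfy `|S| + |M| = |V|`, then `M` matches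
every vertex outside `S` into `S`. -/
theorem IsMatchingSet.exists_partner_mem {G : SimpleGraph V} {M : Finset (Sym2 V)}
    {S : Finset V} (hM : IsMatchingSet G M) (hS : IsIndep G S)
    (hcard : S.card + M.card = Fintype.card V) {v : V} (hv : v ∉ S) :
    ∃ u ∈ S, s(v, u) ∈ M := by
  have hout : ∀ e ∈ M, ∃ x ∈ e, x ∉ S := by
    intro e he
    induction e using Sym2.ind with
    | _ a b =>
      have hab : G.Adj a b := hM.1 _ he
      by_cases ha : a ∈ S
      · exact ⟨b, Sym2.mem_mk_right a b, fun hb => hS a ha b hb hab⟩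
      · exact ⟨a, Sym2.mem_mk_left a b, ha⟩
  choose g hge hgS using hout
  have hcompl : Sᶜ.card ≤ M.card := by
    rw [Finset.card_compl]
    omega
  have hsurj : ∀ x ∉ S, ∃ e, ∃ he : e ∈ M, x = g e he := fun x hx =>
    Finset.surj_on_of_inj_on_of_card_le g (fun e he => Finset.mem_compl.2 (hgS e he))
      (fun e f he hf h => hM.eq_of_mem he hf (hge e he) (h ▸ hge f hf))
      hcompl x (Finset.mem_compl.2 hx)
  obtain ⟨e, he, rfl⟩ := hsurj v hv
  obtain ⟨u, hu⟩ := Sym2.mem_iff_exists.1 (hge e he)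
  refine ⟨u, ?_, hu ▸ he⟩
  by_contra huS
  obtain ⟨f, hf, hfu⟩ := hsurj u huS
  have hue : u ∈ e := by
    rw [hu]
    exact Sym2.mem_mk_right _ _
  have hef : f = e := hM.eq_of_mem hf he (hfu ▸ hge f hf) hue
  subst hef
  have hadj : G.Adj (g f hf) u := by
    rw [← SimpleGraph.mem_edgeSet, ← hu]
    exact hM.1 f hf
  exact hadj.ne hfu.symm

/-- If `G` is a finite König–Egerváry graph, then
`|corona(G)| + |core(G)| = 2α(G)`. -/
theorem corona_card_add_core_card (G : SimpleGraph V)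
    (hke : indepNum G + matchNum G = Fintype.card V) :
    (coronaSet G).card + (coreSet G).card = 2 * indepNum G := by
  obtain ⟨M, hM, hMcard⟩ := exists_isMatchingSet_card_eq_matchNum G
  obtain ⟨S, hS⟩ := exists_isMaxIndep G
  have hpartner : ∀ T : Finset V, IsMaxIndep G T → ∀ v ∉ T, ∃ u ∈ T, s(v, u) ∈ M :=
    fun T hT v hv => hM.exists_partner_mem hT.1 (by rw [hT.2, hMcard, hke]) hv
  have hcore : coreSet G ⊆ S := fun v hv => (Finset.mem_filter.1 hv).2 S hS
  have hcorona : S ⊆ coronaSet G := fun v hv => Finset.mem_filter.2 ⟨Finset.mem_univ v, S, hS, hv⟩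
  choose f hfS hfM using hpartner S hS
  have hbij : (coronaSet G \ S).card = (S \ coreSet G).card := by
    refine Finset.card_bij (fun v hv => f v (Finset.mem_sdiff.1 hv).2) ?_ ?_ ?_
    · intro v hv
      obtain ⟨hvc, hvS⟩ := Finset.mem_sdiff.1 hv
      obtain ⟨T, hT, hvT⟩ := (Finset.mem_filter.1 hvc).2
      exact Finset.mem_sdiff.2 ⟨hfS v hvS, fun hc =>
        hT.1 v hvT _ ((Finset.mem_filter.1 hc).2 T hT) (hM.1 _ (hfM v hvS))⟩
    · intro v hv w hw h
      have hvM := hfM v (Finset.mem_sdiff.1 hv).2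
      have hwM := hfM w (Finset.mem_sdiff.1 hw).2
      rw [← h, Sym2.eq_swap] at hwM
      rw [Sym2.eq_swap] at hvM
      exact hM.eq_right hvM hwM
    · intro u hu
      obtain ⟨huS, huc⟩ := Finset.mem_sdiff.1 hu
      obtain ⟨T, hT, huT⟩ : ∃ T : Finset V, IsMaxIndep G T ∧ u ∉ T := by
        simpa [coreSet] using huc
      obtain ⟨v, hvT, huv⟩ := hpartner T hT u huT
      have hvS : v ∉ S := fun hvS => hS.1 u huS v hvS (hM.1 _ huv)
      refine ⟨v, Finset.mem_sdiff.2
        ⟨Finset.mem_filter.2 ⟨Finset.mem_univ v, T, hT, hvT⟩, hvS⟩, ?_⟩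
      rw [Sym2.eq_swap] at huv
      exact hM.eq_right (hfM v hvS) huv
  have h₁ := Finset.card_sdiff_add_card_eq_card hcorona
  have h₂ := Finset.card_sdiff_add_card_eq_card hcore
  have h₃ := hS.2
  omega
end
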